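/- If a finitely generated group G admits the free group of rank 2 as a quotient (i.e., there is a surjective homomorphism G → F₂), then G is quotient-saturated. -/

import Mathlib

/-- A group is *finitely presented* if it is isomorphic to the quotient of a
finitely generated free group by the normal closure of a finite set of relators. -/
def FinitelyPresented (G : Type*) [Group G] : Prop :=
  ∃ (n : ℕ) (R : Set (FreeGroup (Fin n))), R.Finite ∧
    Nonempty ((FreeGroup (Fin n) ⧸ Subgroup.normalClosure R) ≃* G)

/-- A group `G` is *quotient-saturated* if every finite partial order equipped with a
`{0,1}`-coloring is realizable in `G` by normal subgroups. -/
def QuotientSaturated (G : Type*) [Group G] : Prop :=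
  ∀ (V : Type) [Fintype V] [PartialOrder V] (c : V → Fin 2),
    ∃ N : V → Subgroup G,
      Function.Injective N ∧
      (∀ u v : V, u ≤ v ↔ N u ≤ N v) ∧
      (∀ v : V, ∃ h : (N v).Normal,
        ((letI := h; FinitelyPresented (G ⧸ N v)) ↔ c v = 0))

open scoped commutatorElement

/-- The kernel of a homomorphism from a finitely generated free group onto a finitely presented
group is the normal closure of a finite set. -/
theorem FinitelyPresented.exists_finite_normalClosure_eq {ι Q : Type*} [Finite ι] [Group Q]
    (hQ : FinitelyPresented Q) (f : FreeGroup ι →* Q) (hf : Function.Surjective f) :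
    ∃ T : Set (FreeGroup ι), T.Finite ∧ Subgroup.normalClosure T = f.ker := by
  obtain ⟨n, R, hR, ⟨e⟩⟩ := hQ
  set g : FreeGroup (Fin n) →* Q := e.toMonoidHom.comp (QuotientGroup.mk' _) with hg
  have hgs : Function.Surjective g := e.surjective.comp (QuotientGroup.mk'_surjective _)
  have hgk : ∀ w, g w = 1 ↔ w ∈ Subgroup.normalClosure R := fun w => by simp [hg]
  choose α' hα' using fun i => hgs (f (FreeGroup.of i))
  choose β' hβ' using fun i => hf (g (FreeGroup.of i))
  set α : FreeGroup ι →* FreeGroup (Fin n) := FreeGroup.lift α'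
  set β : FreeGroup (Fin n) →* FreeGroup ι := FreeGroup.lift β'
  have hα : g.comp α = f := FreeGroup.ext_hom _ _ fun i => by simp [α, hα']
  have hβ : f.comp β = g := FreeGroup.ext_hom _ _ fun i => by simp [β, hβ']
  have hα (w) : g (α w) = f w := DFunLike.congr_fun hα w
  have hβ (w) : f (β w) = g w := DFunLike.congr_fun hβ w
  set T : Set (FreeGroup ι) :=
    β '' R ∪ Set.range fun i => (FreeGroup.of i)⁻¹ * β (α (FreeGroup.of i))
  refine ⟨T, (hR.image _).union (Set.finite_range _), le_antisymm ?_ ?_⟩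
  · refine Subgroup.normalClosure_le_normal ?_
    rintro _ (⟨w, hw, rfl⟩ | ⟨i, rfl⟩)
    · simpa [hβ] using (hgk w).2 (Subgroup.subset_normalClosure hw)
    · simp [hα, hβ]
  · intro w hw
    have hmk : (QuotientGroup.mk' (Subgroup.normalClosure T)).comp (β.comp α) =
        QuotientGroup.mk' (Subgroup.normalClosure T) := by
      refine FreeGroup.ext_hom _ _ fun i => (QuotientGroup.eq.2 ?_).symm
      exact Subgroup.subset_normalClosure (Or.inr ⟨i, rfl⟩)
    have hle : Subgroup.normalClosure R ≤ (Subgroup.normalClosure T).comap β :=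
      Subgroup.normalClosure_le_normal fun x hx =>
        Subgroup.subset_normalClosure (Or.inl ⟨x, hx, rfl⟩)
    have hmem : β (α w) ∈ Subgroup.normalClosure T :=
      hle ((hgk _).1 ((hα w).trans hw))
    rw [← QuotientGroup.eq_one_iff] at hmem ⊢
    exact (DFunLike.congr_fun hmk w).symm.trans hmem

/-- Being finitely presented is invariant under isomorphism. -/
theorem FinitelyPresented.of_mulEquiv {G H : Type*} [Group G] [Group H]
    (hG : FinitelyPresented G) (e : G ≃* H) : FinitelyPresented H := by
  obtain ⟨n, R, hR, ⟨e'⟩⟩ := hG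
  exact ⟨n, R, hR, ⟨e'.trans e⟩⟩

/-- Quotient-saturation passes from a quotient to the group. -/
theorem QuotientSaturated.of_surjective {G H : Type*} [Group G] [Group H]
    (hH : QuotientSaturated H) (π : G →* H) (hπ : Function.Surjective π) :
    QuotientSaturated G := by
  intro V _ _ c
  obtain ⟨N, hinj, hle, hfp⟩ := hH V c
  refine ⟨fun v => (N v).comap π, (Subgroup.comap_injective hπ).comp hinj, fun u v => ?_,
    fun v => ?_⟩
  · rw [hle, Subgroup.comap_le_comap_of_surjective hπ]
  · obtain ⟨hn, hv⟩ := hfp v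
    refine ⟨hn.comap π, ?_⟩
    have e : (G ⧸ (N v).comap π) ≃* (H ⧸ N v) :=
      (QuotientGroup.quotientMulEquivOfEq (by
        rw [← MonoidHom.comap_ker, QuotientGroup.ker_mk'])).trans
      (QuotientGroup.quotientKerEquivOfSurjective ((QuotientGroup.mk' (N v)).comp π)
        ((QuotientGroup.mk'_surjective _).comp hπ))
    exact ⟨fun h => hv.1 (h.of_mulEquiv e), fun h => (hv.2 h).of_mulEquiv e.symm⟩

/-- A free group of finite rank realizes a finite colored poset as soon as it contains elements
`r v` and sequences `s v` in the normal closure of `r v` that are independent, as witnessed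
by normal subgroups `K v n`. -/
theorem exists_realization_of_independent {d : ℕ} {V : Type} [Finite V] [PartialOrder V]
    (c : V → Fin 2) (r : V → FreeGroup (Fin d)) (s : V → ℕ → FreeGroup (Fin d))
    (K : V → ℕ → Subgroup (FreeGroup (Fin d))) [hK : ∀ v n, (K v n).Normal]
    (hs : ∀ v n, s v n ∈ Subgroup.normalClosure {r v})
    (hr : ∀ u v n, u ≠ v → r u ∈ K v n)
    (hsK : ∀ v m n, m ≠ n → s v m ∈ K v n) (hsK' : ∀ v n, s v n ∉ K v n) :
    ∃ N : V → Subgroup (FreeGroup (Fin d)),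
      Function.Injective N ∧
      (∀ u v : V, u ≤ v ↔ N u ≤ N v) ∧
      (∀ v : V, ∃ h : (N v).Normal,
        ((letI := h; FinitelyPresented (FreeGroup (Fin d) ⧸ N v)) ↔ c v = 0)) := by
  set J : V → Set (FreeGroup (Fin d)) := fun v => if c v = 0 then {r v} else Set.range (s v)
    with hJ
  set N : V → Subgroup (FreeGroup (Fin d)) :=
    fun v => Subgroup.normalClosure (r '' {u | u < v} ∪ J v)
  have hJr (v) : J v ⊆ Subgroup.normalClosure {r v} := by
    by_cases h : c v = 0
    · simpa [hJ, h] using Subgroup.subset_normalClosure (s := {r v}) rfl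
    · simpa [hJ, h, Set.range_subset_iff] using hs v
  have hsN (v n) : s v n ∈ N v := by
    by_cases h : c v = 0
    · refine Subgroup.normalClosure_mono ?_ (hs v n)
      simp [hJ, h]
    · refine Subgroup.subset_normalClosure (Or.inr ?_)
      simp [hJ, h]
  have hle (u v) : u ≤ v ↔ N u ≤ N v := by
    constructor
    · intro huv
      rcases huv.eq_or_lt with rfl | huv
      · exact le_rfl
      · refine Subgroup.normalClosure_le_normal (Set.union_subset ?_ ?_)
        · rintro _ ⟨w, hw, rfl⟩
          exact Subgroup.subset_normalClosure (Or.inl ⟨w, lt_trans hw huv, rfl⟩)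
        · refine (hJr u).trans (Subgroup.normalClosure_mono ?_)
          exact Set.singleton_subset_iff.2 (Or.inl ⟨u, huv, rfl⟩)
    · intro h
      by_contra huv
      have hr' (w) (hw : w ≤ v) : r w ∈ K u 0 := hr w u 0 (by rintro rfl; exact huv hw)
      refine hsK' u 0 ((?_ : N v ≤ K u 0) (h (hsN u 0)))
      refine Subgroup.normalClosure_le_normal (Set.union_subset ?_ ?_)
      · rintro _ ⟨w, hw, rfl⟩
        exact hr' w (le_of_lt hw)
      · exact (hJr v).trans
          (Subgroup.normalClosure_le_normal (Set.singleton_subset_iff.2 (hr' v le_rfl)))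
  refine ⟨N, fun u v h => le_antisymm ((hle u v).2 h.le) ((hle v u).2 h.ge), hle, fun v =>
    ⟨Subgroup.normalClosure_normal, ?_, ?_⟩⟩
  · intro h
    by_contra hc
    obtain ⟨T, hTf, hT⟩ := h.exists_finite_normalClosure_eq
      (QuotientGroup.mk' (N v)) (QuotientGroup.mk'_surjective _)
    rw [QuotientGroup.ker_mk'] at hT
    let D : Subgroup (FreeGroup (Fin d)) :=
      { carrier := {g | ∀ᶠ n in Filter.cofinite, g ∈ K v n}
        one_mem' := by
          rw [Set.mem_ofPred_eq]
          exact Filter.Eventually.of_forall fun n => one_mem _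
        mul_mem' := by
          simp only [Set.mem_ofPred_eq]
          exact fun h₁ h₂ => h₁.mp (h₂.mono fun n h₂ h₁ => mul_mem h₁ h₂)
        inv_mem' := by simp }
    have hDmem (g) : g ∈ D ↔ ∀ᶠ n in Filter.cofinite, g ∈ K v n := Iff.rfl
    have hD : D.Normal :=
      ⟨fun g h z => (hDmem _).2 (((hDmem g).1 h).mono fun n h => (hK v n).conj_mem g h z)⟩
    have hev : N v ≤ D := by
      refine Subgroup.normalClosure_le_normal ?_
      rintro _ (⟨u, hu, rfl⟩ | hx)
      · exact (hDmem _).2 (Filter.Eventually.of_forall fun n => hr u v n (ne_of_lt hu))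
      · simp only [hJ, hc, if_false] at hx
        obtain ⟨m, rfl⟩ := hx
        exact (hDmem _).2 ((Filter.eventually_cofinite_ne m).mono fun n hn => hsK v m n hn.symm)
    have hT' : ∀ᶠ n in Filter.cofinite, ∀ g ∈ T, g ∈ K v n :=
      (Filter.eventually_all_finite hTf).2 fun g hg =>
        (hDmem g).1 (hev (hT ▸ Subgroup.subset_normalClosure hg))
    obtain ⟨n, hn⟩ := hT'.exists
    refine hsK' v n ((?_ : N v ≤ K v n) (hsN v n))
    rw [← hT]
    exact Subgroup.normalClosure_le_normal hn
  · intro hc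
    refine ⟨d, _, ?_, ⟨MulEquiv.refl _⟩⟩
    simp only [hJ, hc, if_true]
    exact (Set.toFinite _).union (Set.finite_singleton _)

/-- There are elements `f` and `t` such that `f ^ M` commutes with its conjugate by `t ^ (m + 1)`
for all `m ≠ n`, but not for `m = n` if `x ^ M` and `y ^ M` do not commute. -/
theorem exists_commutator_shift_eq_one.{u} {H : Type u} [Group H] (x y : H) (n : ℕ) :
    ∃ (Q : Type u) (_ : Group Q) (f t : Q),
      (∀ M : ℕ, x ^ M = 1 → y ^ M = 1 → f ^ M = 1) ∧
      (∀ M m : ℕ, m ≠ n → ⁅f ^ M, t ^ (m + 1) * f ^ M * (t ^ (m + 1))⁻¹⁆ = 1) ∧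
      (∀ M : ℕ, ¬ Commute (x ^ M) (y ^ M) →
        ⁅f ^ M, t ^ (n + 1) * f ^ M * (t ^ (n + 1))⁻¹⁆ ≠ 1) := by
  set σ : MulAut (ℤ → H) :=
    { toFun := fun g k => g (k + 1)
      invFun := fun g k => g (k - 1)
      left_inv := fun g => by simp
      right_inv := fun g => by simp
      map_mul' := fun g h => rfl }
  have hσ1 (g : ℤ → H) (k : ℤ) : σ g k = g (k + 1) := rfl
  have hpow (m : ℕ) : ∀ (g : ℤ → H) (k : ℤ), (σ ^ m) g k = g (k + m) := by
    induction m with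
    | zero => simp
    | succ m ih =>
      intro g k
      rw [pow_succ, MulAut.mul_apply, ih, hσ1]
      push_cast
      rw [add_assoc]
  set f : ℤ → H := fun k => if k = 0 then x else if k = n + 1 then y else 1 with hf
  have key (M m : ℕ) : ⁅(SemidirectProduct.inl f : (ℤ → H) ⋊[MonoidHom.id _] MulAut (ℤ → H)) ^ M,
      (SemidirectProduct.inr σ ^ (m + 1) * SemidirectProduct.inl f ^ M *
        (SemidirectProduct.inr σ ^ (m + 1))⁻¹ : (ℤ → H) ⋊[MonoidHom.id _] MulAut (ℤ → H))⁆ = 1 ↔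
      ∀ k : ℤ, Commute (f k ^ M) (f (k + (m + 1)) ^ M) := by
    rw [← map_pow, ← map_pow, ← map_inv, ← SemidirectProduct.inl_aut, ← map_commutatorElement,
      map_eq_one_iff _ SemidirectProduct.inl_injective, commutatorElement_eq_one_iff_commute]
    simp [commute_iff_eq, funext_iff, hpow]
  refine ⟨(ℤ → H) ⋊[MonoidHom.id _] MulAut (ℤ → H), inferInstance, SemidirectProduct.inl f,
    SemidirectProduct.inr σ, ?_, ?_, ?_⟩
  · intro M hx hy
    rw [← map_pow, map_eq_one_iff _ SemidirectProduct.inl_injective]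
    ext k
    simp only [hf, Pi.pow_apply, Pi.one_apply]
    split_ifs <;> simp [hx, hy]
  · intro M m hmn
    rw [key]
    intro k
    simp only [hf]
    split_ifs <;> first | omega | simp
  · intro M hM h
    have := (key M n).1 h 0
    simp only [hf] at this
    rw [if_pos trivial, if_neg (by omega), if_pos (by omega)] at this
    exact hM this

/-- The elementary unipotent matrices over `ZMod p` have order dividing `p`, and
their `M`-th powers commute only if `M ^ 2` vanishes modulo `p`. -/
theorem exists_pow_eq_one_not_commute (p : ℕ) [Fact p.Prime] :
    ∃ x y : Matrix.SpecialLinearGroup (Fin 2) (ZMod p),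
      (∀ M, p ∣ M → x ^ M = 1 ∧ y ^ M = 1) ∧
      ∀ M, ¬ p ∣ M → ¬ Commute (x ^ M) (y ^ M) := by
  set x : Matrix.SpecialLinearGroup (Fin 2) (ZMod p) := ⟨!![1, 1; 0, 1], by simp⟩ with hx
  set y : Matrix.SpecialLinearGroup (Fin 2) (ZMod p) := ⟨!![1, 0; 1, 1], by simp⟩ with hy
  have hxp (M : ℕ) : ((x ^ M : Matrix.SpecialLinearGroup (Fin 2) (ZMod p)) :
      Matrix (Fin 2) (Fin 2) (ZMod p)) = !![1, (M : ZMod p); 0, 1] := by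
    induction M with
    | zero => simp [Matrix.one_fin_two]
    | succ M ih =>
      rw [pow_succ, Matrix.SpecialLinearGroup.coe_mul, ih]
      simp [hx, add_comm]
  have hyp (M : ℕ) : ((y ^ M : Matrix.SpecialLinearGroup (Fin 2) (ZMod p)) :
      Matrix (Fin 2) (Fin 2) (ZMod p)) = !![1, 0; (M : ZMod p), 1] := by
    induction M with
    | zero => simp [Matrix.one_fin_two]
    | succ M ih =>
      rw [pow_succ, Matrix.SpecialLinearGroup.coe_mul, ih]
      simp [hy]
  refine ⟨x, y, fun M hM => ?_, fun M hM h => hM ?_⟩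
  · have h0 : (M : ZMod p) = 0 := (ZMod.natCast_eq_zero_iff M p).2 hM
    constructor
    · apply Subtype.ext
      rw [hxp, h0, Matrix.SpecialLinearGroup.coe_one, Matrix.one_fin_two]
    · apply Subtype.ext
      rw [hyp, h0, Matrix.SpecialLinearGroup.coe_one, Matrix.one_fin_two]
  · have h2 := congrArg (fun A : Matrix.SpecialLinearGroup (Fin 2) (ZMod p) =>
      (A : Matrix (Fin 2) (Fin 2) (ZMod p)) 0 0) h.eq
    simp only [Matrix.SpecialLinearGroup.coe_mul, hxp, hyp] at h2
    simpa [ZMod.natCast_eq_zero_iff] using h2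

/-- The free group of rank two is quotient-saturated. -/
theorem quotientSaturated_freeGroup_two : QuotientSaturated (FreeGroup (Fin 2)) := by
  classical
  intro V _ _ c
  set q : V ↪ Nat.Primes := (Fintype.equivFin V).toEmbedding.trans
    (Fin.valEmbedding.trans (Infinite.natEmbedding Nat.Primes))
  have hq (v) : Fact (q v : ℕ).Prime := ⟨(q v).2⟩
  set M : V → ℕ := fun v => ∏ u ∈ Finset.univ.erase v, (q u : ℕ)
  have hdvd (u v) (h : u ≠ v) : (q v : ℕ) ∣ M u :=
    Finset.dvd_prod_of_mem (fun u => (q u : ℕ)) (by simp [h.symm])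
  have hndvd (v) : ¬ (q v : ℕ) ∣ M v := by
    rw [(q v).2.prime.dvd_finsetProd_iff]
    rintro ⟨u, hu, huv⟩
    refine Finset.ne_of_mem_erase hu (q.injective (Subtype.ext ?_))
    exact ((Nat.prime_dvd_prime_iff_eq (q v).2 (q u).2).1 huv).symm
  choose x y hxy hxy' using fun v => exists_pow_eq_one_not_commute (q v)
  choose Q hQ f t hf hft hft' using fun v n => exists_commutator_shift_eq_one (x v) (y v) n
  set φ : ∀ v n, FreeGroup (Fin 2) →* Q v n := fun v n => FreeGroup.lift ![f v n, t v n] with hφ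
  set a : FreeGroup (Fin 2) := FreeGroup.of 0
  set b : FreeGroup (Fin 2) := FreeGroup.of 1
  have hφa (v n) : φ v n a = f v n := by simp [hφ, a]
  have hφb (v n) : φ v n b = t v n := by simp [hφ, b]
  refine exists_realization_of_independent c (fun v => a ^ M v)
    (fun v n => ⁅a ^ M v, b ^ (n + 1) * a ^ M v * (b ^ (n + 1))⁻¹⁆) (fun v n => (φ v n).ker)
    ?_ ?_ ?_ ?_
  · intro v n
    have ha : a ^ M v ∈ Subgroup.normalClosure {a ^ M v} := Subgroup.subset_normalClosure rfl
    have hc := Subgroup.normalClosure_normal.conj_mem _ ha (b ^ (n + 1))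
    exact mul_mem (mul_mem (mul_mem ha hc) (inv_mem ha)) (inv_mem hc)
  · intro u v n huv
    obtain ⟨h1, h2⟩ := hxy v _ (hdvd u v huv)
    simpa [MonoidHom.mem_ker, hφa] using hf v n _ h1 h2
  · intro v m n hmn
    simpa [MonoidHom.mem_ker, hφa, hφb, map_commutatorElement] using hft v n (M v) m hmn
  · intro v n
    simpa [MonoidHom.mem_ker, hφa, hφb, map_commutatorElement] using
      hft' v n (M v) (hxy' v _ (hndvd v))

/-- If a finitely generated group `G` admits the free group of rank 2 as a quotient,
then `G` is quotient-saturated. -/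
theorem stmt_17 {G : Type*} [Group G] (hfg : Group.FG G)
    (hquot : ∃ π : G →* FreeGroup (Fin 2), Function.Surjective π) :
    QuotientSaturated G := by
  obtain ⟨π, hπ⟩ := hquot
  exact quotientSaturated_freeGroup_two.of_surjective π hπ
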